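/- arXiv:2408.03201 — 2 statements merged into one kernel-verified Lean document; each statement's English description precedes it below -/
import Mathlib

section
/- For every infinite cardinal λ, if artin(λ) exists then artin(λ) either has cofinality ℵ₀ or is weakly inaccessible; that is, artin(λ) cannot be a singular cardinal of uncountable cofinality. -/
universe u

structure Alg (ι : Type u) (M : Type u) where
  arity : ι → ℕ
  op : (i : ι) → (Fin (arity i) → M) → M

namespace Alg

variable {ι M : Type u}

/-- A set is closed under all operations of the algebra. -/
def Closed (A : Alg ι M) (S : Set M) : Prop :=
  ∀ (i : ι) (x : Fin (A.arity i) → M), (∀ k, x k ∈ S) → A.op i x ∈ S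

/-- Membership in the subalgebra generated by `X`. -/
inductive cl (A : Alg ι M) (X : Set M) : M → Prop
  | base {m : M} (h : m ∈ X) : cl A X m
  | op (i : ι) (x : Fin (A.arity i) → M) (h : ∀ k, cl A X (x k)) : cl A X (A.op i x)

/-- A subset is free if no element lies in the subalgebra generated by the others. -/
def Free (A : Alg ι M) (X : Set M) : Prop :=
  ∀ x ∈ X, ¬ A.cl (X \ {x}) x

/-- An algebra is Artinian if there is no infinite strictly descending chain of
(nonempty closed) subalgebras. -/
def Artinian (A : Alg ι M) : Prop :=
  ¬ ∃ S : ℕ → Set M, (∀ n, (S n).Nonempty ∧ A.Closed (S n)) ∧ ∀ n, S (n + 1) ⊂ S n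

end Alg

open Cardinal

/-- `ArtinAt lam κ` : every algebra of cardinality κ with at most lam operations is
non-Artinian. -/
def ArtinAt (lam κ : Cardinal.{u}) : Prop :=
  ∀ (ι M : Type u) (A : Alg ι M), #ι ≤ lam → #M = κ → ¬ A.Artinian

/-- `FrAt lam κ` : every algebra of cardinality κ with at most lam operations has an
infinite free subset. -/
def FrAt (lam κ : Cardinal.{u}) : Prop :=
  ∀ (ι M : Type u) (A : Alg ι M), #ι ≤ lam → #M = κ →
    ∃ X : Set M, X.Infinite ∧ A.Free X


namespace Stmt12

open Cardinal Set FirstOrder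

/-- Extend a partial operation along a map, with junk outside of the range. -/
noncomputable def extOp {N M : Type u} [Nonempty M] (j : N → M) {n : ℕ}
    (f : (Fin n → N) → N) (x : Fin n → M) : M :=
  open Classical in
  if h : ∃ y : Fin n → N, ∀ k, j (y k) = x k then j (f h.choose) else Classical.arbitrary M

lemma extOp_eq {N M : Type u} [Nonempty M] {j : N → M} (hj : Function.Injective j) {n : ℕ}
    (f : (Fin n → N) → N) (y : Fin n → N) : extOp j f (fun k => j (y k)) = j (f y) := by
  have h : ∃ z : Fin n → N, ∀ k, j (z k) = j (y k) := ⟨y, fun _ => rfl⟩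
  have hz : h.choose = y := funext fun k => hj (h.choose_spec k)
  unfold extOp
  rw [dif_pos h, hz]

/-- In an Artinian algebra decreasing sequences of closed sets stabilise. -/
lemma stable {ι M : Type u} {A : Alg ι M} (hA : A.Artinian) (S : ℕ → Set M)
    (hS : Antitone S) (hc : ∀ n, A.Closed (S n)) : ∃ n, ∀ m, n ≤ m → S m = S n := by
  by_contra! h
  choose f hf hne using h
  have hss : ∀ n, S (f n) ⊂ S n := fun n => (hS (hf n)).ssubset_of_ne (hne n)
  apply hA
  refine ⟨fun k => S (f^[k] 0), fun n => ⟨?_, hc _⟩, fun n => ?_⟩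
  · obtain ⟨x, hx, -⟩ := exists_of_ssubset (hss (f^[n] 0))
    exact ⟨x, hx⟩
  · simp only [Function.iterate_succ_apply']
    exact hss _

/-- Transfer along a bijection. -/
lemma transfer {ι N M : Type u} (A : Alg ι N) (hA : A.Artinian) (e : N ≃ M) :
    ∃ B : Alg ι M, B.Artinian := by
  refine ⟨⟨A.arity, fun i x => e (A.op i (fun k => e.symm (x k)))⟩, ?_⟩
  rintro ⟨S, h1, h2⟩
  refine hA ⟨fun n => e ⁻¹' (S n), fun n => ⟨?_, ?_⟩, fun n => ?_⟩
  · obtain ⟨x, hx⟩ := (h1 n).1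
    exact ⟨e.symm x, by simpa using hx⟩
  · intro i x hx
    have := (h1 n).2 i (fun k => e (x k)) hx
    simpa using this
  · refine (preimage_mono (h2 n).subset).ssubset_of_ne ?_
    intro h
    exact (h2 n).ne (e.surjective.preimage_injective h)

/-- The language attached to an algebra. -/
def lang {ι M : Type u} (A : Alg ι M) : FirstOrder.Language.{u, u} where
  Functions n := {i : ι // A.arity i = n}
  Relations _ := PEmpty

/-- The structure attached to an algebra. -/
@[reducible] def str {ι M : Type u} (A : Alg ι M) : (lang A).Structure M where
  funMap f x := A.op f.1 (fun k => x (Fin.cast f.2 k))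
  RelMap r := nomatch r

lemma card_term {ι M : Type u} (A : Alg ι M) : #((lang A).Term ℕ) ≤ max ℵ₀ #ι := by
  refine Language.Term.card_le.trans ?_
  have : #(Σ n, (lang A).Functions n) = #ι := mk_congr (Equiv.sigmaFiberEquiv A.arity)
  rw [mk_sum, this]
  simp only [mk_nat, lift_aleph0, lift_uzero]
  exact max_le (le_max_left _ _)
    (add_le_of_le (le_max_left _ _) (le_max_left _ _) (le_max_right _ _))

/-- Valuations from finite tuples. -/
noncomputable def val {M : Type u} [Nonempty M] {k : ℕ} (x : Fin k → M) (j : ℕ) : M :=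
  if h : j < k then x ⟨j, h⟩ else Classical.arbitrary M

lemma exists_term {ι M : Type u} [Nonempty M] (A : Alg ι M) (S : Set M) (x : M)
    (hx : letI := str A; x ∈ Language.Substructure.closure (lang A) S) :
    letI := str A
    ∃ (k : ℕ) (v : Fin k → M) (t : (lang A).Term ℕ), (∀ i, v i ∈ S) ∧ t.realize (val v) = x := by
  classical
  letI := str A
  obtain ⟨t, ht⟩ := Language.Substructure.mem_closure_iff_exists_term.1 hx
  let e := t.varFinset.equivFin
  refine ⟨t.varFinset.card, fun i => ((e.symm i).1 : M), t.restrictVar (fun a => (e a : ℕ)),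
    fun i => (e.symm i).1.2, ?_⟩
  rw [Language.Term.realize_restrictVar ((↑) : S → M), ht]
  intro a
  simp [val]

open Classical in
/-- The combined algebra. -/
noncomputable def comb {ι M J N : Type u} [Nonempty M] (A : Alg ι M) (B : Alg J N) (j : N → M)
    (c : (lang A).Term ℕ → N) : Alg (J ⊕ (ULift.{u} ℕ ⊕ ULift.{u} ℕ)) M where
  arity := Sum.elim B.arity (Sum.elim (fun k => k.down + 1) (fun k => k.down + 1))
  op i := match i with
    | .inl i => fun x => extOp j (B.op i) x
    | .inr (.inl k) => fun (x : Fin (k.down + 1) → M) =>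
      letI := str A
      if h : ∃ t : (lang A).Term ℕ, j (c t) = x 0 then
        h.choose.realize (val (fun i : Fin k.down => x i.succ)) else Classical.arbitrary M
    | .inr (.inr k) => fun (x : Fin (k.down + 1) → M) =>
      letI := str A
      if h : ∃ t : (lang A).Term ℕ, t.realize (val (fun i : Fin k.down => x i.succ)) = x 0 then
        j (c h.choose) else Classical.arbitrary M

lemma comb_artinian {ι M J N : Type u} [Nonempty M] (A : Alg ι M) (B : Alg J N) (j : N → M)
    (c : (lang A).Term ℕ → N) (hA : A.Artinian) (hB : B.Artinian)
    (hj : Function.Injective j) (hc : Function.Injective c) : (comb A B j c).Artinian := by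
  letI := str A
  rintro ⟨S, h1, h2⟩
  have hanti : Antitone S := antitone_nat_of_succ_le fun n => (h2 n).subset
  obtain ⟨n1, hn1⟩ := stable hB (fun n => j ⁻¹' (S n)) (fun a b h => preimage_mono (hanti h)) (by
    intro n i x hx
    have := (h1 n).2 (.inl i) (fun k => j (x k)) hx
    have h3 : (comb A B j c).op (.inl i) (fun k => j (x k)) = j (B.op i x) := extOp_eq hj _ _
    rw [h3] at this
    exact this)
  obtain ⟨n2, hn2⟩ := stable hA
    (fun n => (Language.Substructure.closure (lang A) (S n) : Set M))
    (fun a b h => SetLike.coe_subset_coe.2 (Language.Substructure.closure_mono (hanti h))) (by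
    intro n i x hx
    exact (Language.Substructure.closure (lang A) (S n)).fun_mem
      (⟨i, rfl⟩ : (lang A).Functions (A.arity i)) x hx)
  let n := max n1 n2
  obtain ⟨x, hx, hx'⟩ := exists_of_ssubset (h2 n)
  have hxc : x ∈ (Language.Substructure.closure (lang A) (S (n + 1)) : Set M) := by
    have e1 := hn2 (n + 1) (by omega)
    have e2 := hn2 n (by omega)
    rw [e1, ← e2]
    exact Language.Substructure.subset_closure hx
  obtain ⟨k, v, t, hv, ht⟩ := exists_term A _ _ hxc
  have hex : ∃ t : (lang A).Term ℕ,
      t.realize (val (fun i : Fin k => (Fin.cons x v : Fin (k + 1) → M) i.succ))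
        = (Fin.cons x v : Fin (k + 1) → M) 0 := ⟨t, by simpa using ht⟩
  have hG : j (c hex.choose) ∈ S n := by
    have := (h1 n).2 (.inr (.inr ⟨k⟩)) (Fin.cons x v : Fin (k + 1) → M) (by
      intro i
      refine Fin.cases ?_ ?_ i
      · exact hx
      · intro i
        exact (h2 n).subset (hv i))
    have h3 : (comb A B j c).op (.inr (.inr ⟨k⟩)) (Fin.cons x v : Fin (k + 1) → M)
      = j (c hex.choose) := dif_pos hex
    rwa [h3] at this
  have hG' : j (c hex.choose) ∈ S (n + 1) := by
    have e1 := hn1 (n + 1) (by omega)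
    have e2 := hn1 n (by omega)
    change c hex.choose ∈ j ⁻¹' S (n + 1)
    rw [e1, ← e2]
    exact hG
  have hs := hex.choose_spec
  set t' := hex.choose with ht'
  have hex2 : ∃ t : (lang A).Term ℕ, j (c t) = (Fin.cons (j (c t')) v : Fin (k + 1) → M) 0 :=
    ⟨t', rfl⟩
  have hch : hex2.choose = t' := hc (hj hex2.choose_spec)
  have := (h1 (n + 1)).2 (.inr (.inl ⟨k⟩)) (Fin.cons (j (c t')) v : Fin (k + 1) → M) (by
      intro i
      refine Fin.cases ?_ ?_ i
      · exact hG'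
      · intro i
        exact hv i)
  have h3 : (comb A B j c).op (.inr (.inl ⟨k⟩)) (Fin.cons (j (c t')) v : Fin (k + 1) → M)
      = hex2.choose.realize
        (val (fun i : Fin k => (Fin.cons (j (c t')) v : Fin (k + 1) → M) i.succ)) := dif_pos hex2
  rw [h3, hch] at this
  apply hx'
  simp only [Fin.cons_succ, Fin.cons_zero] at hs this
  rwa [hs] at this

lemma lam_lt {lam κ₀ : Cardinal.{u}} (h : ArtinAt lam κ₀) : lam < κ₀ := by
  by_contra! hle
  refine h κ₀.out κ₀.out ⟨fun _ => 0, fun i _ => i⟩ (by simpa using hle) (by simp) ?_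
  rintro ⟨S, h1, h2⟩
  obtain ⟨x, hx, hx'⟩ := exists_of_ssubset (h2 0)
  exact hx' ((h1 1).2 x Fin.elim0 (fun k => k.elim0))

lemma get {lam κ₀ : Cardinal.{u}} (hleast : IsLeast {κ | ArtinAt lam κ} κ₀) (N : Type u)
    (hN : #N < κ₀) : ∃ (J : Type u) (B : Alg J N), #J ≤ lam ∧ B.Artinian := by
  have : ¬ ArtinAt lam #N := fun h => (hleast.2 h).not_gt hN
  unfold ArtinAt at this
  push Not at this
  obtain ⟨J, N', B, hJ, hN', hB⟩ := this
  obtain ⟨e⟩ := Cardinal.eq.1 hN'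
  obtain ⟨B', hB'⟩ := transfer B hB e
  exact ⟨J, B', hJ, hB'⟩

lemma up {lam κ₀ ν : Cardinal.{u}} (hlam : ℵ₀ ≤ lam)
    (hleast : IsLeast {κ | ArtinAt lam κ} κ₀) (hν : ν < κ₀) : ArtinAt ν κ₀ := by
  intro ι M A hι hM hA
  have hl := lam_lt hleast.1
  have hN : #(max lam ν).out < κ₀ := by simpa using ⟨hl, hν⟩
  obtain ⟨J, B, hJ, hB⟩ := get hleast _ hN
  have hne : Nonempty M := by
    rw [← mk_ne_zero_iff, hM]
    exact (zero_le.trans_lt hl).ne'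
  obtain ⟨j⟩ : Nonempty ((max lam ν).out ↪ M) := by
    rw [← Cardinal.le_def, hM]
    exact hN.le
  obtain ⟨c⟩ : Nonempty ((lang A).Term ℕ ↪ (max lam ν).out) := by
    rw [← Cardinal.le_def]
    refine (card_term A).trans ?_
    rw [mk_out]
    exact max_le_max hlam hι
  refine hleast.1 _ M (comb A B j c) ?_ hM (comb_artinian A B j c hA hB j.2 c.2)
  rw [mk_sum, mk_sum]
  simp only [lift_id, mk_uLift, mk_nat, lift_aleph0, aleph0_add_aleph0]
  exact add_le_of_le hlam hJ hlam

lemma not_succ {lam κ₀ : Cardinal.{u}} (hlam : ℵ₀ ≤ lam)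
    (hleast : IsLeast {κ | ArtinAt lam κ} κ₀) (μ : Cardinal.{u}) : κ₀ ≠ Order.succ μ := by
  rintro rfl
  have hμ : μ < Order.succ μ := Order.lt_succ μ
  have H := up hlam hleast hμ
  let M := (Order.succ μ).ord.ToType
  have hemb : ∀ a : M, Nonempty (Iio a ↪ μ.out) := by
    intro a
    rw [← Cardinal.le_def, mk_out]
    refine Order.lt_succ_iff.1 ((mk_Iio_lt a (by simp [M])).trans_eq (by simp [M]))
  let h := fun a => (hemb a).some
  classical
  let f : μ.out → M → M := fun i a => if hh : ∃ b : Iio a, h a b = i then hh.choose.1 else a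
  have hf : ∀ a b : M, b < a → ∃ i, f i a = b := by
    intro a b hb
    refine ⟨h a ⟨b, hb⟩, ?_⟩
    have hh : ∃ b' : Iio a, h a b' = h a ⟨b, hb⟩ := ⟨_, rfl⟩
    have : hh.choose = ⟨b, hb⟩ := (h a).2 hh.choose_spec
    simp only [f]
    rw [dif_pos hh, this]
  refine H μ.out M ⟨fun _ => 1, fun i x => f i (x 0)⟩ (by simp) (by simp [M]) ?_
  rintro ⟨S, h1, h2⟩
  have hl : ∀ n a b, a ∈ S n → b < a → b ∈ S n := by
    intro n a b ha hb
    obtain ⟨i, rfl⟩ := hf a b hb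
    exact (h1 n).2 i (fun _ => a) (fun _ => ha)
  choose x hx hx' using fun n => exists_of_ssubset (h2 n)
  have hlt : ∀ n, x (n + 1) < x n := by
    intro n
    by_contra! hle
    rcases hle.eq_or_lt with h | h
    · exact hx' n (h ▸ hx (n + 1))
    · exact hx' n (hl _ _ _ (hx (n + 1)) h)
  exact (RelEmbedding.natGT x hlt).not_wellFounded wellFounded_lt

lemma not_sing {lam κ₀ : Cardinal.{u}} (hlam : ℵ₀ ≤ lam)
    (hleast : IsLeast {κ | ArtinAt lam κ} κ₀) (hcof : ℵ₀ < κ₀.ord.cof) : κ₀ ≤ κ₀.ord.cof := by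
  by_contra! hlt
  have hl := lam_lt hleast.1
  have hν : max κ₀.ord.cof lam < κ₀ := max_lt hlt hl
  have H := up hlam hleast hν
  let M := κ₀.ord.ToType
  have hM : #M = κ₀ := by simp [M]
  have hne : Nonempty M := by
    rw [← mk_ne_zero_iff, hM]
    exact (zero_le.trans_lt hl).ne'
  obtain ⟨C, hC, hCc⟩ := Order.exists_cof_eq (α := M)
  have hcM : Order.cof M = κ₀.ord.cof := Ordinal.cof_toType _
  choose J B hJ hB using fun a : M =>
    get hleast (Iio a) ((mk_Iio_lt a (by simp [M])).trans_eq hM)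
  refine H (Σ a : C, J a) M ⟨fun i => (B i.1).arity i.2,
    fun i => extOp Subtype.val ((B i.1).op i.2)⟩ ?_ hM ?_
  · rw [mk_sigma]
    refine (sum_le_sum (fun a : C => #(J a)) (fun _ => lam) (fun a => hJ a)).trans ?_
    rw [sum_const', hCc, hcM]
    exact (mul_eq_max (hcof.le) hlam).le
  rintro ⟨S, h1, h2⟩
  have hanti : Antitone S := antitone_nat_of_succ_le fun n => (h2 n).subset
  choose x hx hx' using fun n => exists_of_ssubset (h2 n)
  have hnc : ¬ IsCofinal (range x) := by
    intro h
    have h4 := Order.cof_le h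
    rw [hcM] at h4
    exact (hcof.trans_le h4).not_ge (mk_le_aleph0_iff.2 (countable_range x).to_subtype)
  obtain ⟨b, hb⟩ : ∃ b, ∀ n, x n < b := by
    simpa [IsCofinal] using hnc
  obtain ⟨a, haC, hba⟩ := hC b
  obtain ⟨n, hn⟩ := stable (hB a) (fun n => (Subtype.val : Iio a → M) ⁻¹' (S n))
    (fun _ _ h => preimage_mono (hanti h)) (by
      intro n i y hy
      have := (h1 n).2 ⟨⟨a, haC⟩, i⟩ (fun k => (y k).1) hy
      simp only at this
      rw [extOp_eq Subtype.val_injective] at this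
      exact this)
  have h5 := hn (n + 1) (by omega)
  have h6 : (⟨x n, (hb n).trans_le hba⟩ : Iio a) ∈ (Subtype.val : Iio a → M) ⁻¹' (S n) := hx n
  rw [← h5] at h6
  exact hx' n h6

end Stmt12

/-- If artin(λ) exists then it has cofinality ℵ₀ or is weakly
inaccessible (regular limit); it cannot be singular of uncountable cofinality. -/
theorem stmt12 (lam κ₀ : Cardinal.{u}) (hlam : ℵ₀ ≤ lam)
    (hleast : IsLeast {κ | ArtinAt lam κ} κ₀) :
    κ₀.ord.cof = ℵ₀ ∨
      (κ₀.IsRegular ∧ ℵ₀ < κ₀ ∧ ∀ μ : Cardinal.{u}, κ₀ ≠ Order.succ μ) := by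
  have hl := Stmt12.lam_lt hleast.1
  have hκ : ℵ₀ < κ₀ := hlam.trans_lt hl
  by_cases hc : κ₀.ord.cof = ℵ₀
  · exact Or.inl hc
  · have h1 : ℵ₀ ≤ κ₀.ord.cof := Ordinal.aleph0_le_cof.2 (isSuccLimit_ord hκ.le)
    have h2 : ℵ₀ < κ₀.ord.cof := lt_of_le_of_ne h1 (Ne.symm hc)
    exact Or.inr ⟨⟨hκ.le, Stmt12.not_sing hlam hleast h2⟩, hκ, Stmt12.not_succ hlam hleast⟩
end

section
/- If the cardinal artin(λ) exists and has cofinality ℵ₀, then artin(λ) = fr(λ), where fr(λ) is the least cardinal κ such that every algebra of cardinality κ with at most λ operations has an infinite free subset. -/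
universe u

open Cardinal

namespace Alg

variable {ι M : Type u}

theorem cl_closed (A : Alg ι M) (X : Set M) : A.Closed {m | A.cl X m} :=
  fun i x h => cl.op i x h

theorem cl_mono (A : Alg ι M) {X Y : Set M} (h : X ⊆ Y) {m : M} (hm : A.cl X m) : A.cl Y m := by
  induction hm with
  | base hx => exact cl.base (h hx)
  | op i x _ ih => exact cl.op i x ih

theorem cl_sub (A : Alg ι M) {X : Set M} (hX : A.Closed X) {m : M} (hm : A.cl X m) : m ∈ X := by
  induction hm with
  | base hx => exact hx
  | op i x _ ih => exact hX i x ih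

theorem Artinian.stab {A : Alg ι M} (hA : A.Artinian) (T : ℕ → Set M)
    (hc : ∀ n, A.Closed (T n)) (ha : Antitone T) : ∃ N, ∀ k, N ≤ k → T k = T N := by
  by_contra hcon
  push Not at hcon
  choose f hf1 hf2 using hcon
  apply hA
  have key : ∀ n, T (f^[n+1] 0) ⊂ T (f^[n] 0) := by
    intro n
    rw [Function.iterate_succ_apply']
    exact lt_of_le_of_ne (ha (hf1 _)) (hf2 _)
  refine ⟨fun n => T (f^[n] 0), fun n => ⟨?_, hc _⟩, key⟩
  obtain ⟨x, hx, _⟩ := Set.exists_of_ssubset (key n)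
  exact ⟨x, hx⟩

/-- The first-order language of an algebra. -/
def lang (A : Alg ι M) : FirstOrder.Language.{u, 0} :=
  ⟨fun n => {i : ι // A.arity i = n}, fun _ => Empty⟩

instance str (A : Alg ι M) : A.lang.Structure M where
  funMap := fun {_} f x => A.op f.1 (fun k => x (Fin.cast f.2 k))
  RelMap := fun {_} r _ => r.elim

theorem closed_realize (A : Alg ι M) {S : Set M} (hS : A.Closed S) {α : Type}
    (t : A.lang.Term α) (v : α → M) (hv : ∀ a, v a ∈ S) : t.realize v ∈ S := by
  induction t with
  | var a => exact hv a
  | func f ts ih => exact hS f.1 _ (fun k => ih _)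

theorem exists_term (A : Alg ι M) {X : Set M} {m : M} (hm : A.cl X m) :
    ∃ (p : ℕ) (t : A.lang.Term (Fin p)) (v : Fin p → M), (∀ i, v i ∈ X) ∧ t.realize v = m := by
  classical
  have : ∃ t : A.lang.Term X, t.realize ((↑) : X → M) = m := by
    induction hm with
    | base hx => exact ⟨FirstOrder.Language.Term.var ⟨_, hx⟩, rfl⟩
    | op i x _ ih =>
      choose ts hts using ih
      refine ⟨FirstOrder.Language.Term.func (L := A.lang) (l := A.arity i) ⟨i, rfl⟩ ts, ?_⟩
      change A.op i _ = _
      congr 1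
      funext k
      exact hts k
  obtain ⟨t, ht⟩ := this
  let e := t.varFinset.equivFin
  refine ⟨_, t.restrictVar e, fun i => (((e.symm i : t.varFinset) : X) : M),
    fun i => ((e.symm i : t.varFinset) : X).2, ?_⟩
  rw [← ht]
  exact FirstOrder.Language.Term.realize_restrictVar _ (by simp)

theorem mk_term (A : Alg ι M) {lam : Cardinal.{u}} (hlam : ℵ₀ ≤ lam) (hι : #ι ≤ lam) (p : ℕ) :
    #(A.lang.Term (Fin p)) ≤ lam := by
  refine FirstOrder.Language.Term.card_le.trans (max_le hlam ?_)
  have h : #(Σ i, A.lang.Functions i) = #ι := mk_congr (Equiv.sigmaFiberEquiv A.arity)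
  rw [mk_sum, h]
  refine add_le_of_le hlam ?_ ?_
  · simp only [mk_fin, lift_natCast]
    exact (natCast_le_aleph0).trans hlam
  · simpa using hι

theorem artinian_of_free (A : Alg ι M) {X : Set M} (hX : X.Infinite) (hf : A.Free X) :
    ¬ A.Artinian := by
  intro hA
  apply hA
  let x := hX.natEmbedding
  refine ⟨fun n => {m | A.cl {y | ∃ k, n ≤ k ∧ y = x k} m}, fun n => ⟨?_, A.cl_closed _⟩, ?_⟩
  · exact ⟨x n, cl.base ⟨n, le_rfl, rfl⟩⟩
  · intro n
    refine ⟨fun m hm => A.cl_mono ?_ hm, fun hsub => ?_⟩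
    · rintro y ⟨k, hk, rfl⟩
      exact ⟨k, by omega, rfl⟩
    · have h1 : A.cl {y | ∃ k, n + 1 ≤ k ∧ y = x k} (x n) := hsub (cl.base ⟨n, le_rfl, rfl⟩)
      refine hf (x n) (x n).2 (A.cl_mono ?_ h1)
      rintro y ⟨k, hk, rfl⟩
      refine ⟨(x k).2, fun he => ?_⟩
      have := x.injective (Subtype.ext he)
      omega

theorem exists_free (A : Alg ι M) (K S : ℕ → Set M) (hK : Monotone K) (hS : Antitone S)
    (hU : ∀ x, ∃ n, x ∈ K n)
    (h : ∀ n k, ∃ x ∈ S k, ∃ k', k < k' ∧ ¬ A.cl (K n ∪ S k') x) :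
    ∃ X : Set M, X.Infinite ∧ A.Free X := by
  choose x hx k' hk' hcl using h
  choose r hr using hU
  let step : ℕ × ℕ → ℕ × ℕ := fun s => (max s.1 (r (x s.1 s.2)), k' s.1 s.2)
  let st : ℕ → ℕ × ℕ := fun i => step^[i] (0, 0)
  have hst : ∀ i, st (i + 1) = step (st i) := fun i => Function.iterate_succ_apply' _ _ _
  have m1 : Monotone fun i => (st i).1 := monotone_nat_of_le_succ fun i => by
    rw [hst]; exact le_max_left _ _
  have m2 : Monotone fun i => (st i).2 := monotone_nat_of_le_succ fun i => by
    rw [hst]; exact (hk' _ _).le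
  let y : ℕ → M := fun i => x (st i).1 (st i).2
  have hlow : ∀ j i, j < i → y j ∈ K (st i).1 := by
    intro j i hji
    have h1 : y j ∈ K (st (j + 1)).1 := by
      rw [hst]; exact hK (le_max_right _ _) (hr _)
    exact hK (m1 hji) h1
  have hhigh : ∀ i j, i < j → y j ∈ S (st (i + 1)).2 := by
    intro i j hij
    exact hS (m2 hij) (hx _ _)
  have hnot : ∀ i, ¬ A.cl (K (st i).1 ∪ S (st (i + 1)).2) (y i) := by
    intro i
    rw [hst]; exact hcl _ _
  have hmem : ∀ i j, j ≠ i → y j ∈ K (st i).1 ∪ S (st (i + 1)).2 := by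
    intro i j hji
    rcases lt_or_gt_of_ne hji with h | h
    · exact Or.inl (hlow _ _ h)
    · exact Or.inr (hhigh _ _ h)
  have hinj : Function.Injective y := by
    intro i j hij
    by_contra hne
    exact hnot i (cl.base (hij ▸ hmem i j (Ne.symm hne)))
  refine ⟨Set.range y, Set.infinite_range_of_injective hinj, ?_⟩
  rintro _ ⟨i, rfl⟩ hc
  refine hnot i (A.cl_mono ?_ hc)
  rintro _ ⟨⟨j, rfl⟩, hj⟩
  exact hmem i j (fun h => hj (by rw [h]; rfl))

/-- Index type for the inverse operations. -/
def GIdx (A : Alg ι M) : Type u :=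
  Σ p : ℕ, A.lang.Term (Fin p) × (Finset (Fin p) × ℕ × Fin p)

theorem mk_GIdx (A : Alg ι M) {lam : Cardinal.{u}} (hlam : ℵ₀ ≤ lam) (hι : #ι ≤ lam) :
    #(A.GIdx) ≤ lam := by
  unfold GIdx
  rw [mk_sigma]
  refine (sum_le_lift_mk_mul_iSup _).trans ?_
  refine mul_le_of_le hlam (by simpa using hlam) (ciSup_le' fun p => ?_)
  rw [mk_prod]
  refine mul_le_of_le hlam (by simpa using A.mk_term hlam hι p) ?_
  have : #(Finset (Fin p) × ℕ × Fin p) ≤ ℵ₀ := mk_le_aleph0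
  calc _ ≤ lift.{u} ℵ₀ := lift_le.2 this
    _ ≤ lam := by simpa using hlam

open Classical in
/-- The expanded algebra. -/
noncomputable def big (A : Alg ι M) (m₀ : M) (K : ℕ → Set M) (J N : ℕ → Type u)
    (C : ∀ n, Alg (J n) (N n)) (e : ∀ n, N n ≃ K n) : Alg (ι ⊕ ((Σ n, J n) ⊕ A.GIdx)) M where
  arity := fun i => match i with
    | .inl i => A.arity i
    | .inr (.inl j) => (C j.1).arity j.2
    | .inr (.inr g) => g.1 + 1
  op := fun i => match i with
    | .inl i => A.op i
    | .inr (.inl j) => fun z => if h : ∀ k, z k ∈ K j.1 then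
        ((e j.1) ((C j.1).op j.2 fun k => (e j.1).symm ⟨z k, h k⟩) : M) else m₀
    | .inr (.inr g) => fun z =>
        if h : ∃ v : Fin g.1 → M, g.2.1.realize v = z (Fin.last _) ∧
          ∀ i, (i ∈ g.2.2.1 → v i ∈ K g.2.2.2.1) ∧ (i ∉ g.2.2.1 → v i = z i.castSucc)
        then h.choose g.2.2.2.2 else m₀

end Alg

theorem exists_cover {κ₀ : Cardinal.{u}} (hinf : ℵ₀ ≤ κ₀) (hcof : κ₀.ord.cof = ℵ₀) {M : Type u}
    (hM : #M = κ₀) : ∃ K : ℕ → Set M, Monotone K ∧ (∀ x, ∃ n, x ∈ K n) ∧ ∀ n, #(K n) < κ₀ := by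
  obtain ⟨s, hs, hs'⟩ := Order.exists_cof_eq κ₀.ord.ToType
  have h1 : #s = ℵ₀ := by
    rw [hs', ← hcof, ← Ordinal.cof_type, Ordinal.type_toType]
  obtain ⟨f⟩ : Nonempty (ℕ ≃ s) := by
    rw [← lift_mk_eq', h1]; simp
  obtain ⟨e⟩ : Nonempty (M ≃ κ₀.ord.ToType) := by
    rw [← Cardinal.eq, hM]; simp
  have hIic : ∀ a : κ₀.ord.ToType, #(Set.Iic a) < κ₀ := by
    intro a
    have := mk_Iic_lt a (by simp) (by simpa using hinf)
    simpa using this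
  refine ⟨fun n => {x | ∃ i ≤ n, e x ≤ f i}, ?_, ?_, ?_⟩
  · rintro m n hmn x ⟨i, hi, hx⟩
    exact ⟨i, hi.trans hmn, hx⟩
  · intro x
    obtain ⟨b, hb, hxb⟩ := hs (e x)
    refine ⟨f.symm ⟨b, hb⟩, f.symm ⟨b, hb⟩, le_rfl, by simpa using hxb⟩
  · intro n
    have : ∃ a : κ₀.ord.ToType, ∀ i ≤ n, (f i : κ₀.ord.ToType) ≤ a := by
      refine ⟨(Finset.range (n+1)).sup' ⟨0, by simp⟩ (fun i => (f i : κ₀.ord.ToType)), ?_⟩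
      intro i hi
      exact Finset.le_sup' (fun i => (f i : κ₀.ord.ToType)) (by simp; omega)
    obtain ⟨a, ha⟩ := this
    refine lt_of_le_of_lt ?_ (hIic a)
    refine mk_le_of_injective (f := fun x => ⟨e x.1, ?_⟩) ?_
    · obtain ⟨i, hi, hx⟩ := x.2
      exact hx.trans (ha i hi)
    · intro x y hxy
      exact Subtype.ext (e.injective (Subtype.ext_iff.1 hxy))

theorem frAt_of (lam κ₀ : Cardinal.{u}) (hlam : ℵ₀ ≤ lam)
    (hart : ArtinAt lam κ₀) (hlt : ∀ κ < κ₀, ¬ ArtinAt lam κ)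
    (hcof : κ₀.ord.cof = ℵ₀) : FrAt lam κ₀ := by
  classical
  intro ι M A hι hM
  have hinf : ℵ₀ ≤ κ₀ := hcof ▸ Ordinal.cof_ord_le κ₀
  obtain ⟨K, hK, hU, hKc⟩ := exists_cover hinf hcof hM
  have hex : ∀ n, ∃ (J N : Type u) (C : Alg J N), #J ≤ lam ∧ #N = #(K n) ∧ C.Artinian := by
    intro n
    have := hlt _ (hKc n)
    unfold ArtinAt at this
    push Not at this
    exact this
  choose J N C hJ hN hC using hex
  have he : ∀ n, Nonempty (N n ≃ K n) := fun n => Cardinal.eq.1 (hN n)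
  let e := fun n => (he n).some
  have hne : Nonempty M := by
    rw [← mk_ne_zero_iff, hM]
    exact (aleph0_pos.trans_le hinf).ne'
  obtain ⟨m₀⟩ := hne
  let B := A.big m₀ K J N C e
  have hB : ¬ B.Artinian := by
    refine hart _ _ B ?_ hM
    rw [mk_sum, mk_sum]
    simp only [lift_id]
    refine add_le_of_le hlam hι (add_le_of_le hlam ?_ (A.mk_GIdx hlam hι))
    rw [mk_sigma]
    refine (sum_le_lift_mk_mul_iSup _).trans ?_
    exact mul_le_of_le hlam (by simpa using hlam) (ciSup_le' hJ)
  unfold Alg.Artinian at hB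
  rw [not_not] at hB
  obtain ⟨S, hS, hSlt⟩ := hB
  have hanti : Antitone S := antitone_nat_of_succ_le fun n => (hSlt n).le
  have hSA : ∀ k, A.Closed (S k) := fun k i x hx => (hS k).2 (.inl i) x hx
  have hstab : ∀ n, ∃ L, ∀ k, L ≤ k → S k ∩ K n ⊆ S (k + 1) := by
    intro n
    obtain ⟨L, hL⟩ := (hC n).stab (fun k => {y | (e n y : M) ∈ S k}) (by
      intro k i x hx
      have h := (hS k).2 (.inr (.inl ⟨n, i⟩)) (fun j => (e n (x j) : M)) hx
      simpa [B, Alg.big] using h) (fun a b hab y hy => hanti hab hy)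
    refine ⟨L, fun k hk x hx => ?_⟩
    have h1 : (e n).symm ⟨x, hx.2⟩ ∈ {y | (e n y : M) ∈ S k} := by simpa using hx.1
    rw [hL k hk, ← hL (k+1) (by omega)] at h1
    simpa using h1
  apply A.exists_free K S hK hanti hU
  by_contra hcon
  push Not at hcon
  obtain ⟨n, k, hk⟩ := hcon
  obtain ⟨L, hL⟩ := hstab n
  obtain ⟨x, hx, hx'⟩ := Set.exists_of_ssubset (hSlt (max k L))
  have hcl := hk x (hanti (le_max_left _ _) hx) (max k L + 1) (by omega)
  generalize hm : max k L = m at *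
  have hLm : L ≤ m := hm ▸ le_max_right _ _
  obtain ⟨p, t, v, hv, hvx⟩ := A.exists_term hcl
  let F : Finset (Fin p) := Finset.univ.filter fun i => v i ∉ S (m + 1)
  let z : Fin (p + 1) → M := Fin.snoc (α := fun _ => M) (fun i => if i ∈ F then x else v i) x
  have hz : ∀ i, z i ∈ S m := by
    intro i
    refine Fin.lastCases ?_ (fun i => ?_) i
    · simpa [z] using hx
    · by_cases hi : i ∈ F
      · simpa [z, hi] using hx
      · have : v i ∈ S (m + 1) := by simpa [F] using hi
        simpa [z, hi] using hanti (Nat.le_succ m) this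
  have hexv : ∃ w : Fin p → M, t.realize w = z (Fin.last _) ∧
          ∀ i, (i ∈ F → w i ∈ K n) ∧ (i ∉ F → w i = z i.castSucc) := by
    refine ⟨v, by simpa [z] using hvx, fun i => ⟨fun hi => ?_, fun hi => by simp [z, hi]⟩⟩
    have : v i ∉ S (m + 1) := by simpa [F] using hi
    exact (hv i).resolve_right this
  have hw : ∀ j, hexv.choose j ∈ S m := by
    intro j
    have h := (hS m).2 (.inr (.inr ⟨p, t, F, n, j⟩)) z hz
    have h2 : B.op (.inr (.inr ⟨p, t, F, n, j⟩)) z = hexv.choose j := dif_pos hexv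
    rwa [h2] at h
  obtain ⟨h1, h2⟩ := hexv.choose_spec

  have hxz : z (Fin.last _) = x := by simp [z]
  replace h1 := h1.trans hxz
  apply hx'
  rw [← h1]
  refine A.closed_realize (hSA _) t _ fun j => ?_
  by_cases hj : j ∈ F
  · exact hL m hLm ⟨hw j, (h2 j).1 hj⟩
  · rw [(h2 j).2 hj]
    have : v j ∈ S (m + 1) := by simpa [F] using hj
    simpa [z, hj] using this

/-- If artin(λ) exists and has cofinality ℵ₀, then artin(λ) = fr(λ):
κ₀ is also the least cardinal at which every algebra with ≤ λ operations has an
infinite free subset. -/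
theorem stmt15 (lam κ₀ : Cardinal.{u}) (hlam : ℵ₀ ≤ lam)
    (hleast : IsLeast {κ | ArtinAt lam κ} κ₀) (hcof : κ₀.ord.cof = ℵ₀) :
    IsLeast {κ | FrAt lam κ} κ₀ := by
  refine ⟨frAt_of lam κ₀ hlam hleast.1 (fun κ hκ h => (hleast.2 h).not_gt hκ) hcof, ?_⟩
  intro κ hκ
  apply hleast.2
  intro ι M A hι hM
  obtain ⟨X, hX, hf⟩ := hκ ι M A hι hM
  exact A.artinian_of_free hX hf
end
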